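/- Multimarginal Kantorovich duality on Polish spaces: for Polish spaces X_1,…,X_K (K≥2), probability measures μ_k ∈ P(X_k), and a bounded continuous cost c : X_1×⋯×X_K → ℝ, the equality inf_{π ∈ Π(μ_1,…,μ_K)} ∫ c dπ = sup_{(f_1,…,f_K) ∈ F_c} ∑_k ∫ f_k dμ_k holds, where F_c is the set of tuples of integrable functions with ∑_k f_k(x_k) ≤ c(x_1,…,x_K) everywhere. -/

import Mathlib

open MeasureTheory
open scoped BoundedContinuousFunction CompactlySupported ENNReal

theorem tight_riesz {Y : Type*} [TopologicalSpace Y] [T35Space Y] [MeasurableSpace Y]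
    [BorelSpace Y] [Nonempty Y] (L : (Y →ᵇ ℝ) →ₗ[ℝ] ℝ) (hpos : ∀ g : Y →ᵇ ℝ, (∀ x, 0 ≤ g x) → 0 ≤ L g)
    (hone : L 1 = 1)
    (htight : ∀ ε : ℝ, 0 < ε → ∃ C : Set Y, IsCompact C ∧ ∀ g : Y →ᵇ ℝ,
      (∀ x, 0 ≤ g x) → (∀ x, g x ≤ 1) → (∀ x ∈ C, g x = 0) → L g ≤ ε) :
    ∃ π : Measure Y, IsProbabilityMeasure π ∧ ∀ g : Y →ᵇ ℝ, ∫ x, g x ∂π = L g := by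
  classical
  let B := StoneCech Y
  let i : Y → B := stoneCechUnit
  have hi : Topology.IsEmbedding i := isEmbedding_stoneCechUnit
  let _ : MeasurableSpace B := borel B
  have : BorelSpace B := ⟨rfl⟩
  -- restriction
  let res : C_c(B, ℝ) → (Y →ᵇ ℝ) := fun h =>
    (BoundedContinuousFunction.mkOfCompact h.toContinuousMap).compContinuous ⟨i, hi.continuous⟩
  have hres : ∀ h x, res h x = h (i x) := fun h x => rfl
  let Λ : C_c(B, ℝ) →ₚ[ℝ] ℝ :=
  { toFun h := L (res h)
    map_add' g g' := by rw [← map_add]; rfl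
    map_smul' c g := by rw [← map_smul]; rfl
    monotone' g g' hgg' := by
      have := hpos (res g' - res g) (fun x => by
        have := hgg' (i x)
        simp only [BoundedContinuousFunction.coe_sub, Pi.sub_apply, hres, sub_nonneg]
        exact this)
      rw [map_sub] at this
      change L (res g) ≤ L (res g')
      linarith }
  let ν := RealRMK.rieszMeasure Λ
  have hν : ∀ h : C_c(B, ℝ), ∫ x, h x ∂ν = L (res h) := fun h => RealRMK.integral_rieszMeasure Λ h
  have hfin : IsFiniteMeasure ν := inferInstanceAs (IsFiniteMeasure (RealRMK.rieszMeasure Λ))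
  have hreg : ν.Regular := inferInstanceAs (RealRMK.rieszMeasure Λ).Regular
  have hnuprob : IsProbabilityMeasure ν := by
    have h := hν ⟨1, HasCompactSupport.of_compactSpace 1⟩
    have e : res ⟨1, HasCompactSupport.of_compactSpace 1⟩ = 1 := by ext x; rfl
    rw [e, hone] at h
    have h2 : ∫ x : B, (1:ℝ) ∂ν = 1 := h
    simp [Measure.real] at h2
    refine ⟨?_⟩
    rw [← ENNReal.toReal_eq_one_iff]; exact h2
  -- concentration
  choose C hC hCL using fun n : ℕ => htight (1 / ((n:ℝ) + 1)) (by positivity)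
  have hCc : ∀ n, IsCompact (i '' C n) := fun n => (hC n).image hi.continuous
  have hbound : ∀ n, ν (i '' C n)ᶜ ≤ ENNReal.ofReal (1 / ((n:ℝ) + 1)) := by
    intro n
    rw [(hCc n).isClosed.isOpen_compl.measure_eq_iSup_isCompact]
    refine iSup_le fun D => iSup_le fun hD => iSup_le fun hDc => ?_
    obtain ⟨f, hf0, hf1, hf⟩ := exists_continuous_zero_one_of_isClosed (hCc n).isClosed
      hDc.isClosed (Set.disjoint_left.2 fun x hx hx' => hD hx' hx)
    let f' : C_c(B, ℝ) := ⟨f, HasCompactSupport.of_compactSpace _⟩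
    have h1 : ν D ≤ ENNReal.ofReal (Λ f') :=
      RealRMK.rieszMeasure_le_of_eq_one Λ (f := f') (fun x => (hf x).1) hDc (fun x hx => hf1 hx)
    refine h1.trans (ENNReal.ofReal_le_ofReal ?_)
    exact hCL n (res f') (fun x => (hf (i x)).1) (fun x => (hf (i x)).2)
      (fun x hx => hf0 ⟨x, hx, rfl⟩)
  let S : Set B := ⋃ n, i '' C n
  have hSm : MeasurableSet S := MeasurableSet.iUnion fun n => (hCc n).isClosed.measurableSet
  have hS0 : ν Sᶜ = 0 := by
    have hle : ∀ n : ℕ, ν Sᶜ ≤ ENNReal.ofReal (1 / ((n:ℝ) + 1)) := fun n =>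
      (measure_mono (Set.compl_subset_compl.2 (Set.subset_iUnion (fun n => i '' C n) n))).trans
        (hbound n)
    have ht : Filter.Tendsto (fun n : ℕ => ENNReal.ofReal (1 / ((n:ℝ) + 1))) Filter.atTop
        (nhds 0) := by
      have := ENNReal.tendsto_ofReal (tendsto_one_div_add_atTop_nhds_zero_nat (𝕜 := ℝ))
      simpa using this
    exact le_antisymm (ge_of_tendsto' ht hle) bot_le
  let y0 : Y := Classical.arbitrary Y
  let r : B → Y := fun z => if z ∈ S then Function.invFun i z else y0
  have hri : ∀ y, i y ∈ S → r (i y) = y := fun y hy => by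
    simp only [r, hy, if_true]
    exact Function.leftInverse_invFun hi.injective y
  have hir : ∀ z ∈ S, i (r z) = z := by
    intro z hz
    obtain ⟨n, y, hy, rfl⟩ := Set.mem_iUnion.1 hz
    rw [hri y hz]
  have hrm : Measurable r := by
    have hr1 : Measurable (S.domRestrict r) := by
      apply measurable_of_isClosed
      intro A hA
      have : S.domRestrict r ⁻¹' A = Subtype.val ⁻¹' (⋃ n, i '' (A ∩ C n)) := by
        ext ⟨z, hz⟩
        simp only [Set.mem_preimage, Set.domRestrict_apply, Set.mem_iUnion]
        constructor
        · intro h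
          obtain ⟨n, y, hy, rfl⟩ := Set.mem_iUnion.1 hz
          rw [hri y hz] at h
          exact ⟨n, y, ⟨h, hy⟩, rfl⟩
        · rintro ⟨n, y, ⟨h, hy⟩, rfl⟩
          rw [hri y hz]; exact h
      rw [this]
      exact measurable_subtype_coe (MeasurableSet.iUnion fun n =>
        (((hC n).inter_left hA).image hi.continuous).isClosed.measurableSet)
    have hr2 : Measurable (Sᶜ.domRestrict r) := by
      have : Sᶜ.domRestrict r = fun _ => y0 := by
        ext ⟨z, hz⟩
        have hz' : z ∉ S := hz
        simp [r, hz', Set.domRestrict_apply]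
      rw [this]; exact measurable_const
    exact measurable_of_restrict_of_restrict_compl hSm hr1 hr2
  refine ⟨ν.map r, Measure.isProbabilityMeasure_map hrm.aemeasurable, fun g => ?_⟩
  have hgb : ∀ y, g y ∈ Set.Icc (-‖g‖) ‖g‖ := fun y => abs_le.1 (g.norm_coe_le_norm y)
  let g1 : Y → Set.Icc (-‖g‖) ‖g‖ := fun y => ⟨g y, hgb y⟩
  have hg1 : Continuous g1 := g.continuous.subtype_mk _
  let G : C_c(B, ℝ) := ⟨⟨fun z => ((stoneCechExtend hg1 z : Set.Icc (-‖g‖) ‖g‖) : ℝ),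
    continuous_subtype_val.comp (continuous_stoneCechExtend hg1)⟩,
    HasCompactSupport.of_compactSpace _⟩
  have hG : ∀ y, G (i y) = g y := fun y =>
    congrArg Subtype.val (stoneCechExtend_stoneCechUnit hg1 y)
  have e : res G = g := by ext y; exact hG y
  rw [integral_map hrm.aemeasurable g.continuous.measurable.aestronglyMeasurable, ← e, ← hν G]
  apply integral_congr_ae
  have : ∀ᵐ z ∂ν, z ∈ S := by rw [ae_iff]; exact hS0
  filter_upwards [this] with z hz
  rw [hres, hir z hz]

theorem exists_linear_le_sublinear {E : Type*} [AddCommGroup E] [Module ℝ E] (N : E → ℝ)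
    (N_hom : ∀ c : ℝ, 0 < c → ∀ x, N (c • x) = c * N x) (N_add : ∀ x y, N (x + y) ≤ N x + N y)
    (a : E) : ∃ L : E →ₗ[ℝ] ℝ, (∀ x, L x ≤ N x) ∧ L a = N a := by
  have N0 : N 0 = 0 := by
    have := N_hom 2 (by norm_num) 0
    rw [smul_zero] at this; linarith
  have H : ∀ c : ℝ, c • a = 0 → (RingHom.id ℝ) c • N a = 0 := by
    intro c hc
    rcases smul_eq_zero.1 hc with h | h
    · simp [h]
    · simp [h, N0]
  obtain ⟨g, hg, hgN⟩ := exists_extension_of_le_sublinear (LinearPMap.mkSpanSingleton' a (N a) H) N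
    N_hom N_add (by
      rintro ⟨x, hx⟩
      obtain ⟨c, rfl⟩ := Submodule.mem_span_singleton.1 hx
      rw [LinearPMap.mkSpanSingleton'_apply]
      simp only [RingHom.id_apply, smul_eq_mul]
      rcases lt_trichotomy c 0 with h | h | h
      · have h1 := N_hom (-c) (by linarith) a
        have h2 := N_add (c • a) ((-c) • a)
        rw [neg_smul, add_neg_cancel, N0, ← neg_smul, h1] at h2
        linarith
      · simp [h, N0]
      · rw [N_hom c h])
  refine ⟨g, hgN, ?_⟩
  have := hg ⟨a, Submodule.mem_span_singleton_self a⟩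
  exact this.trans (LinearPMap.mkSpanSingleton'_apply_self a (N a) H _)

theorem tube_functions {K : ℕ} {X : Fin K → Type*}
    [∀ k, TopologicalSpace (X k)] [∀ k, PolishSpace (X k)]
    (C : ∀ k, Set (X k)) (hC : ∀ k, IsCompact (C k)) (U : Set (∀ k, X k)) (hU : IsOpen U)
    (hCU : Set.pi Set.univ C ⊆ U) :
    ∃ f : ∀ k, BoundedContinuousFunction (X k) ℝ, (∀ k x, 0 ≤ f k x) ∧ (∀ k x, f k x ≤ 1) ∧
      (∀ k, ∀ x ∈ C k, f k x = 0) ∧ ∀ x : ∀ k, X k, x ∉ U → ∃ k, f k (x k) = 1 := by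
  let _ : ∀ k, MetricSpace (X k) := fun k => TopologicalSpace.metrizableSpaceMetric (X k)
  obtain ⟨r, hr, hrU⟩ := (isCompact_univ_pi hC).exists_thickening_subset_open hU hCU
  have hex : ∀ k, ∃ f : C(X k, ℝ), Set.EqOn f 0 (C k) ∧
      Set.EqOn f 1 (Metric.thickening r (C k))ᶜ ∧ ∀ x, f x ∈ Set.Icc (0:ℝ) 1 := fun k =>
    exists_continuous_zero_one_of_isClosed (hC k).isClosed Metric.isOpen_thickening.isClosed_compl
      (Set.disjoint_left.2 fun x hx hx' => hx' (Metric.self_subset_thickening hr _ hx))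
  choose f hf0 hf1 hf using hex
  refine ⟨fun k => BoundedContinuousFunction.ofNormedAddCommGroup (f k) (f k).continuous 1
    (fun x => ?_), fun k x => (hf k x).1, fun k x => (hf k x).2, fun k x hx => hf0 k hx, ?_⟩
  · rw [Real.norm_eq_abs, abs_of_nonneg (hf k x).1]; exact (hf k x).2
  · intro x hx
    by_contra hcon
    push Not at hcon
    apply hx
    apply hrU
    have : ∀ k, ∃ z ∈ C k, dist (x k) z < r := by
      intro k
      rw [← Metric.mem_thickening_iff]
      by_contra hk
      exact hcon k (hf1 k hk)
    choose z hz hzd using this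
    exact Metric.mem_thickening_iff.2 ⟨z, fun k _ => hz k, (dist_pi_lt_iff hr).2 hzd⟩

theorem exists_coupling {K : ℕ} (hK : 2 ≤ K) {X : Fin K → Type*}
    [∀ k, TopologicalSpace (X k)] [∀ k, PolishSpace (X k)]
    [∀ k, MeasurableSpace (X k)] [∀ k, BorelSpace (X k)]
    (μ : ∀ k, Measure (X k)) [∀ k, IsProbabilityMeasure (μ k)]
    (c : BoundedContinuousFunction (∀ k, X k) ℝ) :
    ∃ π : Measure (∀ k, X k), IsProbabilityMeasure π ∧
        (∀ k, π.map (fun x => x k) = μ k) ∧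
        ∀ ε : ℝ, 0 < ε → ∃ f : ∀ k, BoundedContinuousFunction (X k) ℝ,
          (∀ x, ∑ k, f k (x k) ≤ c x) ∧ ∫ x, c x ∂π ≤ ∑ k, ∫ y, f k y ∂(μ k) + ε := by
  classical
  have hne : ∀ k, Nonempty (X k) := fun k => (μ k).nonempty_of_neZero
  let P : Measure (∀ k, X k) := Measure.pi μ
  have hPint : ∀ f : ∀ k, BoundedContinuousFunction (X k) ℝ,
      ∫ x, ∑ k, f k (x k) ∂P = ∑ k, ∫ y, f k y ∂(μ k) := by
    intro f
    have hmp : ∀ k, MeasurePreserving (fun x : ∀ k, X k => x k) P (μ k) := fun k =>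
      measurePreserving_eval μ k
    rw [integral_finsetSum]
    · refine Finset.sum_congr rfl fun k _ => ?_
      rw [← (hmp k).map_eq, integral_map (hmp k).measurable.aemeasurable
        (f k).continuous.measurable.aestronglyMeasurable]
    · intro k _
      exact (hmp k).integrable_comp_of_integrable ((f k).integrable _)
  let T : BoundedContinuousFunction (∀ k, X k) ℝ → Set ℝ := fun g =>
    {r | ∃ f : ∀ k, BoundedContinuousFunction (X k) ℝ, (∀ x, g x ≤ ∑ k, f k (x k)) ∧
      r = ∑ k, ∫ y, f k y ∂(μ k)}
  have hTlb : ∀ g, ∀ r ∈ T g, ∫ x, g x ∂P ≤ r := by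
    rintro g r ⟨f, hf, rfl⟩
    rw [← hPint]
    refine integral_mono (g.integrable _) ?_ hf
    refine integrable_finsetSum _ fun k _ => ?_
    exact (measurePreserving_eval μ k).integrable_comp_of_integrable ((f k).integrable _)
  have hTb : ∀ g, BddBelow (T g) := fun g => ⟨_, fun r hr => hTlb g r hr⟩
  have hTne : ∀ g, (T g).Nonempty := by
    intro g
    refine ⟨_, fun k => BoundedContinuousFunction.const _ ‖g‖, fun x => ?_, rfl⟩
    have h1 := (le_abs_self _).trans (g.norm_coe_le_norm x)
    simp only [BoundedContinuousFunction.const_apply, Finset.sum_const, Finset.card_univ,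
      Fintype.card_fin, nsmul_eq_mul]
    have : (2:ℝ) ≤ K := by exact_mod_cast hK
    nlinarith [norm_nonneg g]
  let N : BoundedContinuousFunction (∀ k, X k) ℝ → ℝ := fun g => sInf (T g)
  have hNle : ∀ g (f : ∀ k, BoundedContinuousFunction (X k) ℝ), (∀ x, g x ≤ ∑ k, f k (x k)) →
      N g ≤ ∑ k, ∫ y, f k y ∂(μ k) := fun g f hf => csInf_le (hTb g) ⟨f, hf, rfl⟩
  have N_add : ∀ x y, N (x + y) ≤ N x + N y := by
    intro g h
    refine le_of_forall_pos_le_add fun ε hε => ?_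
    obtain ⟨_, ⟨f1, hf1, rfl⟩, h1⟩ := exists_lt_of_csInf_lt (hTne g)
      (show N g < N g + ε / 2 by linarith)
    obtain ⟨_, ⟨f2, hf2, rfl⟩, h2⟩ := exists_lt_of_csInf_lt (hTne h)
      (show N h < N h + ε / 2 by linarith)
    have h3 := hNle (g + h) (fun k => f1 k + f2 k) (fun x => by
      simp only [BoundedContinuousFunction.coe_add, Pi.add_apply, Finset.sum_add_distrib]
      linarith [hf1 x, hf2 x])
    have h4 : ∑ k, ∫ y, (f1 k + f2 k) y ∂(μ k) =
        ∑ k, ∫ y, f1 k y ∂(μ k) + ∑ k, ∫ y, f2 k y ∂(μ k) := by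
      rw [← Finset.sum_add_distrib]
      exact Finset.sum_congr rfl fun k _ =>
        integral_add ((f1 k).integrable _) ((f2 k).integrable _)
    linarith
  have N_hom1 : ∀ t : ℝ, 0 < t → ∀ g, N (t • g) ≤ t * N g := by
    intro t ht g
    rw [← div_le_iff₀' ht]
    refine le_csInf (hTne g) ?_
    rintro _ ⟨f, hf, rfl⟩
    rw [div_le_iff₀' ht]
    have h3 := hNle (t • g) (fun k => t • f k) (fun x => by
      simp only [BoundedContinuousFunction.coe_smul, smul_eq_mul, ← Finset.mul_sum]
      exact mul_le_mul_of_nonneg_left (hf x) ht.le)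
    refine h3.trans (le_of_eq ?_)
    rw [Finset.mul_sum]
    refine Finset.sum_congr rfl fun k _ => ?_
    simp only [BoundedContinuousFunction.coe_smul, smul_eq_mul, integral_const_mul]
  have N_hom : ∀ t : ℝ, 0 < t → ∀ g, N (t • g) = t * N g := by
    intro t ht g
    refine le_antisymm (N_hom1 t ht g) ?_
    have := N_hom1 t⁻¹ (inv_pos.2 ht) (t • g)
    rw [smul_smul, inv_mul_cancel₀ ht.ne', one_smul] at this
    rwa [le_inv_mul_iff₀ ht] at this
  have hNex : ∀ g, ∀ ε : ℝ, 0 < ε → ∃ r ∈ T g, r < N g + ε := fun g ε hε =>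
    exists_lt_of_csInf_lt (hTne g) (show N g < N g + ε by linarith)
  clear_value N
  obtain ⟨L, hLN, hLc⟩ := exists_linear_le_sublinear N N_hom N_add (-c)
  have hLpos : ∀ g : BoundedContinuousFunction (∀ k, X k) ℝ, (∀ x, 0 ≤ g x) → 0 ≤ L g := by
    intro g hg
    have h1 := hLN (-g)
    have h2 := hNle (-g) (fun k => 0) (fun x => by simpa using hg x)
    simp only [BoundedContinuousFunction.coe_zero, Pi.zero_apply, integral_zero,
      Finset.sum_const_zero] at h2
    rw [map_neg] at h1
    linarith
  have hLM : ∀ (g : BoundedContinuousFunction (∀ k, X k) ℝ)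
      (f : ∀ k, BoundedContinuousFunction (X k) ℝ), (∀ x, g x = ∑ k, f k (x k)) →
      L g = ∑ k, ∫ y, f k y ∂(μ k) := by
    intro g f hf
    have h1 := (hLN g).trans (hNle g f fun x => (hf x).le)
    have h2 := (hLN (-g)).trans (hNle (-g) (fun k => - f k) fun x => by
      simp [hf x])
    simp only [map_neg, BoundedContinuousFunction.coe_neg, Pi.neg_apply, integral_neg,
      Finset.sum_neg_distrib] at h2
    linarith
  -- one coordinate
  have hLk : ∀ (k : Fin K) (f : BoundedContinuousFunction (X k) ℝ),
      L (f.compContinuous ⟨fun x => x k, continuous_apply k⟩) = ∫ y, f y ∂(μ k) := by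
    intro k f
    rw [hLM _ (Pi.single k f)]
    · rw [Finset.sum_eq_single k]
      · simp
      · intro j _ hj
        simp [Pi.single_eq_of_ne hj]
      · simp
    · intro x
      rw [Finset.sum_eq_single k]
      · simp
      · intro j _ hj
        simp [Pi.single_eq_of_ne hj]
      · simp
  have hLone : L 1 = 1 := by
    have h := hLk ⟨0, by omega⟩ 1
    simp only [BoundedContinuousFunction.coe_one, Pi.one_apply, integral_const,
      probReal_univ, smul_eq_mul, mul_one] at h
    exact h
  have htight : ∀ ε : ℝ, 0 < ε → ∃ C : Set (∀ k, X k), IsCompact C ∧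
      ∀ g : BoundedContinuousFunction (∀ k, X k) ℝ,
      (∀ x, 0 ≤ g x) → (∀ x, g x ≤ 1) → (∀ x ∈ C, g x = 0) → L g ≤ ε := by
    intro ε hε
    have hKpos : (0:ℝ) < K := by exact_mod_cast (by omega : 0 < K)
    have hex : ∀ k, ∃ C : Set (X k), IsCompact C ∧ (μ k) Cᶜ ≤ ENNReal.ofReal (ε / (2 * K)) := by
      intro k
      obtain ⟨C, hC, h⟩ := isTightMeasureSet_iff_exists_isCompact_measure_compl_le.1
        (isTightMeasureSet_singleton (μ := μ k)) (ENNReal.ofReal (ε / (2 * K)))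
        (ENNReal.ofReal_pos.2 (by positivity))
      exact ⟨C, hC, h _ rfl⟩
    choose C hC hCμ using hex
    refine ⟨Set.pi Set.univ C, isCompact_univ_pi hC, fun g hg0 hg1 hgC => ?_⟩
    obtain ⟨f, hf0, hf1, hfC, hfU⟩ := tube_functions C hC {x | g x < ε / 2}
      (isOpen_lt g.continuous continuous_const) (fun x hx => by
        simp only [Set.mem_ofPred_eq, hgC x hx]; positivity)
    let F : BoundedContinuousFunction (∀ k, X k) ℝ :=
      ∑ k, (f k).compContinuous ⟨fun x => x k, continuous_apply k⟩
    have hF : ∀ x, F x = ∑ k, f k (x k) := fun x => by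
      simp [F, BoundedContinuousFunction.sum_apply]
    have hdom : 0 ≤ L ((ε / 2) • (1 : BoundedContinuousFunction (∀ k, X k) ℝ) + F - g) := by
      apply hLpos
      intro x
      have hsum : 0 ≤ ∑ k, f k (x k) := Finset.sum_nonneg fun k _ => hf0 k _
      simp only [BoundedContinuousFunction.coe_sub, BoundedContinuousFunction.coe_add,
        BoundedContinuousFunction.coe_smul, Pi.sub_apply, Pi.add_apply, hF,
        BoundedContinuousFunction.coe_one, Pi.one_apply, smul_eq_mul, mul_one]
      by_cases hx : g x < ε / 2
      · linarith
      · obtain ⟨k, hk⟩ := hfU x hx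
        have := Finset.single_le_sum (f := fun k => f k (x k)) (fun k _ => hf0 k (x k))
          (Finset.mem_univ k)
        simp only [hk] at this
        linarith [hg1 x]
    rw [map_sub, map_add, map_smul, hLone, hLM F f hF] at hdom
    have hint : ∀ k, ∫ y, f k y ∂(μ k) ≤ ε / (2 * K) := by
      intro k
      have hm : MeasurableSet (C k)ᶜ := (hC k).isClosed.measurableSet.compl
      calc ∫ y, f k y ∂(μ k) ≤ ∫ y, (C k)ᶜ.indicator (fun _ => (1:ℝ)) y ∂(μ k) := by
            refine integral_mono ((f k).integrable _) ((integrable_const _).indicator hm) ?_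
            intro y
            by_cases hy : y ∈ C k
            · simp [hfC k y hy, hy]
            · simp [hy, hf1 k y]
        _ = (μ k).real (C k)ᶜ := by
            rw [integral_indicator hm]; simp
        _ ≤ ε / (2 * K) := ENNReal.toReal_le_of_le_ofReal (by positivity) (hCμ k)
    have hs : ∑ k, ∫ y, f k y ∂(μ k) ≤ ε / 2 := by
      refine (Finset.sum_le_sum fun k _ => hint k).trans (le_of_eq ?_)
      simp only [Finset.sum_const, Finset.card_univ, Fintype.card_fin, nsmul_eq_mul]
      field_simp
    simp only [smul_eq_mul, mul_one] at hdom
    linarith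
  have hPol : PolishSpace (∀ k, X k) := inferInstance
  have hmet : TopologicalSpace.MetrizableSpace (∀ k, X k) := inferInstance
  have hT4 : T4Space (∀ k, X k) := by
    let _ : MetricSpace (∀ k, X k) := TopologicalSpace.metrizableSpaceMetric _
    infer_instance
  have hT35 : T35Space (∀ k, X k) := T4Space.instT35Space
  have hNon : Nonempty (∀ k, X k) := inferInstance
  have hBor : BorelSpace (∀ k, X k) := inferInstance
  obtain ⟨π, hπ, hπL⟩ := tight_riesz L hLpos hLone htight
  refine ⟨π, hπ, fun k => ?_, fun ε hε => ?_⟩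
  · have hmk : Measurable (fun x : ∀ k, X k => x k) := measurable_pi_apply k
    have : IsProbabilityMeasure (π.map (fun x => x k)) :=
      Measure.isProbabilityMeasure_map hmk.aemeasurable
    refine ext_of_forall_integral_eq_of_IsFiniteMeasure fun f => ?_
    rw [integral_map hmk.aemeasurable f.continuous.measurable.aestronglyMeasurable, ← hLk k f,
      ← hπL]
    rfl
  · obtain ⟨_, ⟨f, hf, rfl⟩, h1⟩ := hNex (-c) ε hε
    refine ⟨fun k => - f k, fun x => ?_, ?_⟩
    · have := hf x
      simp only [BoundedContinuousFunction.coe_neg, Pi.neg_apply, Finset.sum_neg_distrib] at this ⊢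
      linarith
    · rw [map_neg] at hLc
      rw [hπL]
      simp only [BoundedContinuousFunction.coe_neg, Pi.neg_apply, integral_neg,
        Finset.sum_neg_distrib]
      linarith

/-- Multimarginal Kantorovich duality on Polish spaces, for a bounded
continuous cost. -/
theorem kantorovich_duality_polish {K : ℕ} (hK : 2 ≤ K) {X : Fin K → Type*}
    [∀ k, TopologicalSpace (X k)] [∀ k, PolishSpace (X k)]
    [∀ k, MeasurableSpace (X k)] [∀ k, BorelSpace (X k)]
    (μ : ∀ k, Measure (X k)) [∀ k, IsProbabilityMeasure (μ k)]
    (c : (∀ k, X k) → ℝ) (hc_cont : Continuous c)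
    (hc_bdd : ∃ M : ℝ, ∀ x, |c x| ≤ M) :
    sInf {r : ℝ | ∃ π : Measure (∀ k, X k), IsProbabilityMeasure π ∧
        (∀ k, π.map (fun x => x k) = μ k) ∧ r = ∫ x, c x ∂π}
      = sSup {r : ℝ | ∃ f : ∀ k, X k → ℝ,
          (∀ k, Measurable (f k)) ∧ (∀ k, Integrable (f k) (μ k)) ∧
          (∀ x : ∀ k, X k, (∑ k, f k (x k)) ≤ c x) ∧
          r = ∑ k, ∫ y, f k y ∂(μ k)} := by
  obtain ⟨M, hM⟩ := hc_bdd
  let c' : BoundedContinuousFunction (∀ k, X k) ℝ :=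
    BoundedContinuousFunction.ofNormedAddCommGroup c hc_cont M hM
  set A := {r : ℝ | ∃ π : Measure (∀ k, X k), IsProbabilityMeasure π ∧
        (∀ k, π.map (fun x => x k) = μ k) ∧ r = ∫ x, c x ∂π} with hA
  set B := {r : ℝ | ∃ f : ∀ k, X k → ℝ,
          (∀ k, Measurable (f k)) ∧ (∀ k, Integrable (f k) (μ k)) ∧
          (∀ x : ∀ k, X k, (∑ k, f k (x k)) ≤ c x) ∧
          r = ∑ k, ∫ y, f k y ∂(μ k)} with hB
  have hweak : ∀ r ∈ B, ∀ s ∈ A, r ≤ s := by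
    rintro _ ⟨f, hfm, hfi, hfc, rfl⟩ _ ⟨π, hπ, hπm, rfl⟩
    have hmp : ∀ k, MeasurePreserving (fun x : ∀ k, X k => x k) π (μ k) := fun k =>
      ⟨measurable_pi_apply k, hπm k⟩
    have hi : ∀ k, Integrable (fun x : ∀ k, X k => f k (x k)) π := fun k =>
      (hmp k).integrable_comp_of_integrable (hfi k)
    have h1 : ∑ k, ∫ y, f k y ∂(μ k) = ∫ x, ∑ k, f k (x k) ∂π := by
      rw [integral_finsetSum _ fun k _ => hi k]
      refine Finset.sum_congr rfl fun k _ => ?_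
      rw [← hπm k, integral_map (measurable_pi_apply k).aemeasurable
        (hfm k).aestronglyMeasurable]
    rw [h1]
    exact integral_mono (integrable_finsetSum _ fun k _ => hi k) (c'.integrable π) hfc
  obtain ⟨π, hπ, hπm, hπc⟩ := exists_coupling hK μ c'
  have hmemA : ∫ x, c x ∂π ∈ A := ⟨π, hπ, hπm, rfl⟩
  have hmemB : ∀ f : ∀ k, BoundedContinuousFunction (X k) ℝ, (∀ x, ∑ k, f k (x k) ≤ c' x) →
      ∑ k, ∫ y, f k y ∂(μ k) ∈ B := fun f hf =>
    ⟨fun k => f k, fun k => (f k).continuous.measurable, fun k => (f k).integrable _, hf, rfl⟩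
  obtain ⟨f0, hf0, _⟩ := hπc 1 one_pos
  have hBne : B.Nonempty := ⟨_, hmemB f0 hf0⟩
  have hAb : BddBelow A := ⟨_, fun s hs => hweak _ (hmemB f0 hf0) s hs⟩
  have hBb : BddAbove B := ⟨_, fun r hr => hweak r hr _ hmemA⟩
  refine le_antisymm ?_ (csSup_le hBne fun r hr => le_csInf ⟨_, hmemA⟩ fun s hs => hweak r hr s hs)
  refine le_of_forall_pos_le_add fun ε hε => ?_
  obtain ⟨f, hf, hfε⟩ := hπc ε hε
  have h1 : sInf A ≤ ∫ x, c x ∂π := csInf_le hAb hmemA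
  have h2 := le_csSup hBb (hmemB f hf)
  have h3 : ∫ x, c x ∂π ≤ ∑ k, ∫ y, f k y ∂(μ k) + ε := hfε
  linarith
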